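/- For every integer n ≥ 1: the integral group ring ℤSₙ of the symmetric group Sₙ contains a free pair (u, β^m) formed by a Bass cyclic unit u and a positive power β^m of a bicyclic unit β if and only if n ≥ 5; and the same statement holds with Sₙ replaced by the alternating group Aₙ. -/

import Mathlib

/-- `u` and `v` form a free pair. -/
def IsFreePair {G : Type*} [Group G] (u v : G) : Prop :=
  Function.Injective ((FreeGroup.lift (fun b : Bool => if b then u else v)) : FreeGroup Bool →* G)

/-- `ĥ = 1 + h + h² + ⋯ + h^{d-1}` in `ℤG`, where `d` is the order of `h`. -/
noncomputable def hat {G : Type*} [Group G] (h : G) : MonoidAlgebra ℤ G :=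
  ∑ i ∈ Finset.range (orderOf h), (MonoidAlgebra.of ℤ G h) ^ i

/-- The bicyclic unit `β_{x,h} = 1 + (1 − h)·x·ĥ` of `ℤG`. -/
noncomputable def bicyclicBeta {G : Type*} [Group G] (x h : G) : MonoidAlgebra ℤ G :=
  1 + (1 - MonoidAlgebra.of ℤ G h) * MonoidAlgebra.of ℤ G x * hat h

/-- The bicyclic unit `γ_{x,h} = 1 + ĥ·x·(1 − h)` of `ℤG`. -/
noncomputable def bicyclicGamma {G : Type*} [Group G] (x h : G) : MonoidAlgebra ℤ G :=
  1 + hat h * MonoidAlgebra.of ℤ G x * (1 - MonoidAlgebra.of ℤ G h)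

/-- `u ∈ ℤG` is a bicyclic unit (of either type). -/
def IsBicyclicUnit {G : Type*} [Group G] (u : MonoidAlgebra ℤ G) : Prop :=
  ∃ x h : G, u = bicyclicBeta x h ∨ u = bicyclicGamma x h

/-- The Bass cyclic unit
`u_{k,m}(x) = (1 + x + ⋯ + x^{k-1})^m + ((1 − k^m)/d)·(1 + x + ⋯ + x^{d-1})` of `ℤG`,
where `d` is the order of `x`. -/
noncomputable def bassCyclic {G : Type*} [Group G] (x : G) (k m : ℕ) : MonoidAlgebra ℤ G :=
  (∑ i ∈ Finset.range k, (MonoidAlgebra.of ℤ G x) ^ i) ^ m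
    + ((1 - (k : ℤ) ^ m) / (orderOf x : ℤ)) •
        ∑ i ∈ Finset.range (orderOf x), (MonoidAlgebra.of ℤ G x) ^ i

/-- `u ∈ ℤG` is a Bass cyclic unit: `u = u_{k,m}(x)` with `gcd(k, d) = 1` and
`φ(d) ∣ m`, where `d` is the order of `x`. -/
def IsBassCyclicUnit {G : Type*} [Group G] (u : MonoidAlgebra ℤ G) : Prop :=
  ∃ (x : G) (k m : ℕ), 0 < k ∧ 0 < m ∧ Nat.Coprime k (orderOf x) ∧
    (orderOf x).totient ∣ m ∧ u = bassCyclic x k m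

/-- `ℤG` contains a free pair `(u, β^m)` formed by a Bass cyclic unit `u` and a positive
power of a bicyclic unit `β`. -/
def HasBassBicyclicFreePair (G : Type*) [Group G] : Prop :=
  ∃ (u β : (MonoidAlgebra ℤ G)ˣ) (m : ℕ), 0 < m ∧
    IsBassCyclicUnit (u : MonoidAlgebra ℤ G) ∧ IsBicyclicUnit (β : MonoidAlgebra ℤ G) ∧
    IsFreePair u (β ^ m)

section PartOne

/-- the augmentation map -/
noncomputable def augm (G : Type*) [Group G] : MonoidAlgebra ℤ G →ₐ[ℤ] ℤ :=
  MonoidAlgebra.lift ℤ ℤ G (1 : G →* ℤ)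

theorem augm_of {G : Type*} [Group G] (g : G) : augm G (MonoidAlgebra.of ℤ G g) = 1 := by
  simp [augm]

theorem pow_mul_absorb {R : Type*} [Ring R] (t N : R) (e : ℤ) (h1 : t * N = e • N) (m : ℕ) :
    t ^ m * N = e ^ m • N := by
  induction m with
  | zero => simp
  | succ m ih => rw [pow_succ, mul_assoc, h1, mul_smul_comm, ih, smul_smul, pow_succ, mul_comm]

theorem pow_expand {R : Type*} [Ring R] (t N : R) (a d e : ℤ) (hN : N * N = d • N)
    (h1 : t * N = e • N) (h2 : N * t = e • N) (m : ℕ) :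
    ∃ c : ℤ, (t + a • N) ^ m = t ^ m + c • N := by
  induction m with
  | zero => exact ⟨0, by simp⟩
  | succ m ih =>
    obtain ⟨c, hc⟩ := ih
    refine ⟨a * e ^ m + c * e + c * a * d, ?_⟩
    rw [pow_succ, hc, add_mul, mul_add, mul_add, mul_smul_comm, pow_mul_absorb t N e h1,
      smul_mul_assoc, h2, smul_mul_assoc, mul_smul_comm, hN, pow_succ, add_smul, add_smul,
      smul_smul, smul_smul, smul_smul, smul_smul]
    abel

variable {G : Type*} [Group G]

theorem of_pow_orderOf (x : G) : (MonoidAlgebra.of ℤ G x) ^ orderOf x = 1 := by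
  rw [← map_pow, pow_orderOf_eq_one, map_one]

theorem of_mul_hat (x : G) : MonoidAlgebra.of ℤ G x * hat x = hat x := by
  have h := mul_geom_sum (MonoidAlgebra.of ℤ G x) (orderOf x)
  rw [of_pow_orderOf, sub_self, sub_mul, one_mul, sub_eq_zero] at h
  exact h

theorem hat_mul_of (x : G) : hat x * MonoidAlgebra.of ℤ G x = hat x := by
  have h := geom_sum_mul (MonoidAlgebra.of ℤ G x) (orderOf x)
  rw [of_pow_orderOf, sub_self, mul_sub, mul_one, sub_eq_zero] at h
  exact h

theorem of_pow_mul_hat (x : G) (i : ℕ) : MonoidAlgebra.of ℤ G x ^ i * hat x = hat x := by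
  induction i with
  | zero => rw [pow_zero, one_mul]
  | succ i ih => rw [pow_succ, mul_assoc, of_mul_hat, ih]

theorem hat_mul_of_pow (x : G) (i : ℕ) : hat x * MonoidAlgebra.of ℤ G x ^ i = hat x := by
  induction i with
  | zero => simp
  | succ i ih => rw [pow_succ, ← mul_assoc, ih, hat_mul_of]

theorem geom_mul_hat (x : G) (k : ℕ) :
    (∑ i ∈ Finset.range k, MonoidAlgebra.of ℤ G x ^ i) * hat x = (k : ℤ) • hat x := by
  rw [Finset.sum_mul]; simp only [of_pow_mul_hat]; simp

theorem hat_mul_geom (x : G) (k : ℕ) :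
    hat x * (∑ i ∈ Finset.range k, MonoidAlgebra.of ℤ G x ^ i) = (k : ℤ) • hat x := by
  rw [Finset.mul_sum]; simp only [hat_mul_of_pow]; simp

theorem hat_mul_hat (x : G) : hat x * hat x = (orderOf x : ℤ) • hat x :=
  geom_mul_hat x (orderOf x)

theorem augm_geom (x : G) (k : ℕ) :
    augm G (∑ i ∈ Finset.range k, MonoidAlgebra.of ℤ G x ^ i) = k := by
  rw [map_sum]; simp only [map_pow, augm_of]; simp

theorem augm_hat (x : G) : augm G (hat x) = orderOf x := augm_geom x _

theorem dvd_bass (d k m : ℕ) (hk : Nat.Coprime k d) (hm : d.totient ∣ m) :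
    (d : ℤ) ∣ 1 - (k : ℤ) ^ m := by
  obtain ⟨l, rfl⟩ := hm
  have h := (Nat.ModEq.pow_totient hk).pow l
  rw [one_pow, ← pow_mul] at h
  have := (Int.natCast_modEq_iff.mpr h).dvd
  simpa using this

theorem augm_bass (x : G) (k m : ℕ) (hk : Nat.Coprime k (orderOf x))
    (hm : (orderOf x).totient ∣ m) : augm G (bassCyclic x k m) = 1 := by
  unfold bassCyclic
  rw [map_add, map_pow, augm_geom, map_zsmul, augm_geom, smul_eq_mul,
    Int.ediv_mul_cancel (dvd_bass _ _ _ hk hm)]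
  ring

/-- an element of augmentation one, of the form `v + c N` with `v` of augmentation one, is `v`. -/
theorem eq_of_augm (x : G) (hx : orderOf x ≠ 0) (u v : MonoidAlgebra ℤ G) (c : ℤ)
    (h : u = v + c • hat x) (hu : augm G u = 1) (hv : augm G v = 1) : u = v := by
  have h1 := congrArg (augm G) h
  rw [map_add, map_zsmul, augm_hat, hu, hv, smul_eq_mul] at h1
  have : c = 0 := by
    have h2 : c * (orderOf x : ℤ) = 0 := by linarith
    rcases mul_eq_zero.mp h2 with h2 | h2
    · exact h2
    · exact absurd (by exact_mod_cast h2) hx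
  rw [h, this]; simp

theorem geom_reduce (x : G) (q r : ℕ) :
    (∑ i ∈ Finset.range (orderOf x * q + r), MonoidAlgebra.of ℤ G x ^ i)
      = (∑ i ∈ Finset.range r, MonoidAlgebra.of ℤ G x ^ i) + (q : ℤ) • hat x := by
  induction q with
  | zero => simp
  | succ q ih =>
    have : orderOf x * (q + 1) + r = orderOf x + (orderOf x * q + r) := by ring
    rw [this, Finset.sum_range_add]
    simp only [pow_add, of_pow_orderOf, one_mul]
    rw [ih, Nat.cast_add, add_smul, Nat.cast_one, one_smul]
    change hat x + _ = _
    abel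

theorem geom_small (x : G) (hx : orderOf x ≠ 0) (hx4 : orderOf x ≤ 4) (k : ℕ)
    (hk : Nat.Coprime k (orderOf x)) :
    (∃ a : ℤ, (∑ i ∈ Finset.range k, MonoidAlgebra.of ℤ G x ^ i) = 1 + a • hat x) ∨
    (3 ≤ orderOf x ∧ ∃ a : ℤ, (∑ i ∈ Finset.range k, MonoidAlgebra.of ℤ G x ^ i)
      = -MonoidAlgebra.of ℤ G x ^ (orderOf x - 1) + a • hat x) := by
  have hr : k % orderOf x < orderOf x := Nat.mod_lt _ (Nat.pos_of_ne_zero hx)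
  have hcop : Nat.Coprime (k % orderOf x) (orderOf x) := by
    rw [Nat.coprime_iff_gcd_eq_one, ← Nat.gcd_rec, Nat.gcd_comm]; exact hk
  have hg := geom_reduce x (k / orderOf x) (k % orderOf x)
  rw [Nat.div_add_mod] at hg
  rw [hg]
  have cases : (orderOf x = 1 ∧ k % orderOf x = 0) ∨ k % orderOf x = 1 ∨
      (3 ≤ orderOf x ∧ k % orderOf x + 1 = orderOf x) := by
    generalize k % orderOf x = r at *
    generalize orderOf x = d at *
    interval_cases d <;> interval_cases r <;> simp_all (decide := true)
  generalize k % orderOf x = r at *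
  rcases cases with ⟨h1, rfl⟩ | rfl | ⟨h1, h2⟩
  · left
    refine ⟨(k / orderOf x : ℕ) - 1, ?_⟩
    have : hat x = 1 := by unfold hat; rw [h1, Finset.sum_range_one, pow_zero]
    rw [this, sub_smul]; simp
  · left; exact ⟨_, by simp; rfl⟩
  · right
    refine ⟨h1, (k / orderOf x : ℕ) + 1, ?_⟩
    have : hat x = (∑ i ∈ Finset.range r, MonoidAlgebra.of ℤ G x ^ i)
        + MonoidAlgebra.of ℤ G x ^ (orderOf x - 1) := by
      conv_lhs => unfold hat
      rw [← h2, Finset.sum_range_succ, Nat.add_sub_cancel]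
    rw [add_smul, one_smul]
    nth_rewrite 3 [this]
    abel

theorem bass_torsion (x : G) (hx : orderOf x ≠ 0) (hx4 : orderOf x ≤ 4) (k m : ℕ)
    (hk : Nat.Coprime k (orderOf x)) (hm : (orderOf x).totient ∣ m) :
    bassCyclic x k m ^ orderOf x = 1 := by
  suffices h : ∃ j : ℕ, bassCyclic x k m = MonoidAlgebra.of ℤ G x ^ j by
    obtain ⟨j, hj⟩ := h
    rw [hj, ← pow_mul, mul_comm, pow_mul, of_pow_orderOf, one_pow]
  have haug := augm_bass x k m hk hm
  rcases geom_small x hx hx4 k hk with ⟨a, ha⟩ | ⟨h3, a, ha⟩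
  · obtain ⟨c, hc⟩ := pow_expand (1 : MonoidAlgebra ℤ G) (hat x) a _ 1 (hat_mul_hat x)
      (by simp) (by simp) m
    refine ⟨0, ?_⟩
    refine eq_of_augm x hx _ _ (c + (1 - (k : ℤ) ^ m) / (orderOf x : ℤ)) ?_ haug (by simp)
    unfold bassCyclic
    rw [ha, hc, add_smul]
    simp only [one_pow, pow_zero, add_assoc]
    rfl
  · obtain ⟨c, hc⟩ := pow_expand (-MonoidAlgebra.of ℤ G x ^ (orderOf x - 1)) (hat x) a _ (-1)
      (hat_mul_hat x) (by rw [neg_mul, of_pow_mul_hat]; simp)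
      (by rw [mul_neg, hat_mul_of_pow]; simp) m
    have heven : Even m := by
      have : Even (orderOf x).totient := Nat.totient_even (by omega)
      obtain ⟨l, rfl⟩ := hm
      exact this.mul_right l
    refine ⟨(orderOf x - 1) * m, ?_⟩
    refine eq_of_augm x hx _ _ (c + (1 - (k : ℤ) ^ m) / (orderOf x : ℤ)) ?_ haug
      (by rw [map_pow, augm_of, one_pow])
    unfold bassCyclic
    rw [ha, hc, add_smul, heven.neg_pow, ← pow_mul]
    simp only [add_assoc]
    rfl

theorem no_free_pair (hG : ∀ g : G, ∃ e : ℕ, 0 < e ∧ e ≤ 4 ∧ g ^ e = 1) :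
    ¬ HasBassBicyclicFreePair G := by
  rintro ⟨u, β, m, -, ⟨x, k, m', -, -, hk, hm, hu⟩, -, hfree⟩
  obtain ⟨e, he, he4, hxe⟩ := hG x
  have hle : orderOf x ≤ e := orderOf_le_of_pow_eq_one he hxe
  have h0 : orderOf x ≠ 0 := (orderOf_pos_iff.mpr (isOfFinOrder_iff_pow_eq_one.mpr ⟨e, he, hxe⟩)).ne'
  have ht := bass_torsion x h0 (by omega) k m' hk hm
  rw [← hu] at ht
  have hu1 : u ^ orderOf x = 1 := by
    apply Units.ext
    push_cast
    exact ht
  have h1 : (FreeGroup.of true : FreeGroup Bool) ^ orderOf x = 1 := by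
    apply hfree
    rw [map_pow, FreeGroup.lift_apply_of, map_one]
    simpa using hu1
  have h2 := congrArg (FreeGroup.lift (fun _ : Bool => Multiplicative.ofAdd (1 : ℤ))) h1
  rw [map_pow, FreeGroup.lift_apply_of, map_one (FreeGroup.lift _), ← ofAdd_nsmul] at h2
  have h3 : orderOf x • (1 : ℤ) = 0 := h2
  exact h0 (by simpa using h3)

set_option maxRecDepth 100000 in
theorem perm_small (n : ℕ) (hn : 1 ≤ n) (h : n < 5) (g : Equiv.Perm (Fin n)) :
    ∃ e : ℕ, 0 < e ∧ e ≤ 4 ∧ g ^ e = 1 := by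
  have : g ^ 1 = 1 ∨ g ^ 2 = 1 ∨ g ^ 3 = 1 ∨ g ^ 4 = 1 := by
    interval_cases n <;> revert g <;> decide
  rcases this with h | h | h | h
  exacts [⟨1, by norm_num, by norm_num, h⟩, ⟨2, by norm_num, by norm_num, h⟩,
    ⟨3, by norm_num, by norm_num, h⟩, ⟨4, by norm_num, by norm_num, h⟩]

end PartOne

section Transfer

theorem transfer {H G : Type*} [Group H] [Group G] (f : H →* G) (hf : Function.Injective f)
    (h : HasBassBicyclicFreePair H) : HasBassBicyclicFreePair G := by
  obtain ⟨u, β, m, hm, ⟨x, k, m', hk0, hm0, hk, hm', hu⟩, ⟨y, z, hβ⟩, hfree⟩ := h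
  let F : MonoidAlgebra ℤ H →+* MonoidAlgebra ℤ G := MonoidAlgebra.mapDomainRingHom ℤ f
  have hF : Function.Injective F := MonoidAlgebra.mapDomain_injective hf
  have hof : ∀ a : H, F (MonoidAlgebra.of ℤ H a) = MonoidAlgebra.of ℤ G (f a) := by
    intro a; simp [F]
  have ho : ∀ a : H, orderOf (f a) = orderOf a := fun a => orderOf_injective f hf a
  have hhat : ∀ a : H, F (hat a) = hat (f a) := by
    intro a; unfold hat; rw [map_sum, ho]; simp only [map_pow, hof]
  refine ⟨Units.map F u, Units.map F β, m, hm, ⟨f x, k, m', hk0, hm0, by rwa [ho], by rwa [ho], ?_⟩,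
    ⟨f y, f z, ?_⟩, ?_⟩
  · rw [Units.coe_map, hu]
    change F _ = _
    unfold bassCyclic
    rw [map_add, map_pow, map_sum, map_zsmul, map_sum, ho]
    simp only [map_pow, hof]
  · rw [Units.coe_map]
    refine hβ.imp (fun h => ?_) (fun h => ?_)
    · rw [h]
      change F _ = _
      unfold bicyclicBeta
      simp only [map_add, map_one, map_mul, map_sub, hof, hhat]
    · rw [h]
      change F _ = _
      unfold bicyclicGamma
      simp only [map_add, map_one, map_mul, map_sub, hof, hhat]
  · unfold IsFreePair at *
    have hmap : Function.Injective (Units.map (F : MonoidAlgebra ℤ H →* MonoidAlgebra ℤ G)) :=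
      Units.map_injective hF
    have := hmap.comp hfree
    convert this using 1
    rw [← MonoidHom.coe_comp]
    congr 1
    ext b
    cases b <;> simp

end Transfer

section PingPong

/-- nonzero vectors of the plane -/
abbrev NZ : Type := {v : ℝ × ℝ // v ≠ 0}

/-- the diagonal map `diag(1, l)` on nonzero vectors -/
noncomputable def diagPerm (l : ℝ) (hl : l ≠ 0) : Equiv.Perm NZ where
  toFun v := ⟨(v.1.1, l * v.1.2), by
    intro h
    apply v.2
    simp only [Prod.mk_eq_zero, mul_eq_zero, hl, false_or] at h
    exact Prod.ext h.1 h.2⟩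
  invFun v := ⟨(v.1.1, l⁻¹ * v.1.2), by
    intro h
    apply v.2
    simp only [Prod.mk_eq_zero, mul_eq_zero, inv_eq_zero, hl, false_or] at h
    exact Prod.ext h.1 h.2⟩
  left_inv v := by
    apply Subtype.ext
    simp [hl]
  right_inv v := by
    apply Subtype.ext
    simp [hl]

/-- the transvection `1 + k (1,1) ⊗ (1,-1)` on nonzero vectors -/
noncomputable def transPerm (k : ℝ) : Equiv.Perm NZ where
  toFun v := ⟨(v.1.1 + k * (v.1.1 - v.1.2), v.1.2 + k * (v.1.1 - v.1.2)), by
    intro h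
    apply v.2
    simp only [Prod.mk_eq_zero] at h
    have h3 : v.1.1 - v.1.2 = 0 := by linarith [h.1, h.2]
    rw [h3] at h
    exact Prod.ext (by simpa using h.1) (by simpa using h.2)⟩
  invFun v := ⟨(v.1.1 - k * (v.1.1 - v.1.2), v.1.2 - k * (v.1.1 - v.1.2)), by
    intro h
    apply v.2
    simp only [Prod.mk_eq_zero] at h
    have h3 : v.1.1 - v.1.2 = 0 := by linarith [h.1, h.2]
    rw [h3] at h
    exact Prod.ext (by simpa using h.1) (by simpa using h.2)⟩
  left_inv v := by
    apply Subtype.ext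
    ext <;> simp
  right_inv v := by
    apply Subtype.ext
    ext <;> simp

/-- attracting sets -/
def setX (b : Bool) : Set NZ :=
  if b then {v | 10 * |v.1.1| < |v.1.2|}
  else {v | 2 * (v.1.1 - v.1.2) ^ 2 ≤ v.1.1 * (v.1.1 - v.1.2)}

/-- repelling sets -/
def setY (b : Bool) : Set NZ :=
  if b then {v | 10 * |v.1.2| < |v.1.1|}
  else {v | v.1.1 * (v.1.1 - v.1.2) < -(2 * (v.1.1 - v.1.2) ^ 2)}

theorem nz_cases (v : NZ) : v.1.1 ≠ 0 ∨ v.1.2 ≠ 0 := by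
  by_contra! h
  exact v.2 (Prod.ext h.1 h.2)

theorem aux1 (s t : ℝ) (h : 10 * |s| < |t|) : |s * (s - t)| < 2 * (s - t) ^ 2 := by
  have h0 := abs_nonneg s
  have h1 : |t| - |s| ≤ |s - t| := by rw [abs_sub_comm]; exact abs_sub_abs_le_abs_sub t s
  rw [abs_mul, ← sq_abs (s - t)]
  nlinarith

theorem aux2 (s t : ℝ) (h : 10 * |t| < |s|) : |s * (s - t)| < 2 * (s - t) ^ 2 := by
  have h0 := abs_nonneg t
  have h1 : |s| - |t| ≤ |s - t| := abs_sub_abs_le_abs_sub s t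
  rw [abs_mul, ← sq_abs (s - t)]
  nlinarith

theorem pingpong (l k : ℝ) (hl : 100 < l) (hk : 5 < k) :
    Function.Injective (FreeGroup.lift
      (fun b : Bool => if b then diagPerm l (by linarith) else transPerm k)) := by
  apply FreeGroup.injective_lift_of_ping_pong _ (α := NZ) setX setY
  · rintro (_ | _)
    · exact ⟨⟨(1, 1), by simp⟩, by simp [setX]⟩
    · exact ⟨⟨(0, 1), by simp⟩, by simp [setX]⟩
  · have key : Disjoint (setX true) (setX false) := by
      rw [Set.disjoint_left]
      intro v h1 h2
      simp only [setX, if_true, Set.mem_ofPred_eq, Bool.false_eq_true, if_false] at h1 h2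
      have := aux1 _ _ h1
      rw [abs_lt] at this; linarith
    rintro (_ | _) (_ | _) h
    · exact absurd rfl h
    · exact key.symm
    · exact key
    · exact absurd rfl h
  · have key : Disjoint (setY true) (setY false) := by
      rw [Set.disjoint_left]
      intro v h1 h2
      simp only [setY, if_true, Set.mem_ofPred_eq, Bool.false_eq_true, if_false] at h1 h2
      have := aux2 _ _ h1
      rw [abs_lt] at this; linarith
    rintro (_ | _) (_ | _) h
    · exact absurd rfl h
    · exact key.symm
    · exact key
    · exact absurd rfl h
  · rintro (_ | _) (_ | _) <;> rw [Set.disjoint_left] <;> intro v h1 h2 <;>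
      simp only [setX, setY, if_true, Set.mem_ofPred_eq, Bool.false_eq_true, if_false] at h1 h2
    · nlinarith [sq_nonneg (v.1.1 - v.1.2)]
    · have := aux2 _ _ h2
      rw [abs_lt] at this; linarith
    · have := aux1 _ _ h1
      rw [abs_lt] at this; linarith
    · linarith [abs_nonneg v.1.1, abs_nonneg v.1.2]
  · rintro (_ | _) _ ⟨v, hv, rfl⟩
    · simp only [setX, setY, Set.mem_compl_iff, Set.mem_ofPred_eq, Bool.false_eq_true, if_false,
        not_lt, Equiv.Perm.smul_def, transPerm, Equiv.coe_fn_mk] at hv ⊢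
      have : v.1.1 + k * (v.1.1 - v.1.2) - (v.1.2 + k * (v.1.1 - v.1.2)) = v.1.1 - v.1.2 := by ring
      rw [this]
      nlinarith [sq_nonneg (v.1.1 - v.1.2)]
    · simp only [setX, setY, Set.mem_compl_iff, Set.mem_ofPred_eq, if_true,
        not_lt, Equiv.Perm.smul_def, diagPerm, Equiv.coe_fn_mk] at hv ⊢
      rw [abs_mul, abs_of_pos (by linarith : 0 < l)]
      have h2 : 0 < |v.1.2| := by
        rcases nz_cases v with h | h
        · have := abs_pos.mpr h; linarith
        · exact abs_pos.mpr h
      nlinarith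
  · rintro (_ | _) _ ⟨v, hv, rfl⟩
    · have e : (fun b : Bool => if b then diagPerm l (by linarith) else transPerm k)⁻¹ false • v
          = (transPerm k).symm v := rfl
      change _ • v ∈ _
      rw [e]
      simp only [setX, setY, Set.mem_compl_iff, Set.mem_ofPred_eq, Bool.false_eq_true, if_false,
        not_le, transPerm, Equiv.coe_fn_symm_mk] at hv ⊢
      have : v.1.1 - k * (v.1.1 - v.1.2) - (v.1.2 - k * (v.1.1 - v.1.2)) = v.1.1 - v.1.2 := by ring
      rw [this]
      nlinarith [sq_nonneg (v.1.1 - v.1.2)]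
    · have e : (fun b : Bool => if b then diagPerm l (by linarith) else transPerm k)⁻¹ true • v
          = (diagPerm l (by linarith)).symm v := rfl
      change _ • v ∈ _
      rw [e]
      simp only [setX, setY, Set.mem_compl_iff, Set.mem_ofPred_eq, if_true,
        not_lt, diagPerm, Equiv.coe_fn_symm_mk] at hv ⊢
      have hl0 : 0 < l := by linarith
      rw [abs_mul, abs_of_pos (inv_pos.mpr hl0)]
      have h2 : 0 < |v.1.1| := by
        rcases nz_cases v with h | h
        · exact abs_pos.mpr h
        · have := abs_pos.mpr h; linarith
      have h3 : l⁻¹ * |v.1.2| = |v.1.2| / l := by field_simp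
      rw [h3, ← mul_div_assoc, div_lt_iff₀ hl0]
      nlinarith

/-- the abstract freeness criterion -/
theorem free_of_intertwine {H W : Type*} [Group H] [MulAction H W] (ι : NZ → W)
    (hι : Function.Injective ι) (u v : H) (l k : ℝ) (hl : 100 < l) (hk : 5 < k)
    (hu : ∀ p, u • ι p = ι (diagPerm l (by linarith) p))
    (hv : ∀ p, v • ι p = ι (transPerm k p)) : IsFreePair u v := by
  unfold IsFreePair
  rw [injective_iff_map_eq_one]
  intro w hw
  have hinv : ∀ (g : H) (e : Equiv.Perm NZ), (∀ p, g • ι p = ι (e p)) →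
      ∀ p, g⁻¹ • ι p = ι (e⁻¹ p) := by
    intro g e h p
    rw [inv_smul_eq_iff, h]; simp
  have key : ∀ w : FreeGroup Bool, ∀ p,
      (FreeGroup.lift (fun b : Bool => if b then u else v) w) • ι p =
      ι (FreeGroup.lift (fun b : Bool => if b then diagPerm l (by linarith) else transPerm k) w p) := by
    intro w
    induction w using FreeGroup.induction_on with
    | C1 => intro p; simp
    | of b =>
      intro p
      rw [FreeGroup.lift_apply_of, FreeGroup.lift_apply_of]
      cases b
      · exact hv p
      · exact hu p
    | inv_of b h =>
      rw [map_inv, map_inv]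
      exact hinv _ _ h
    | mul a b ha hb =>
      intro p
      rw [map_mul, map_mul, mul_smul, hb, ha]; rfl
  apply (injective_iff_map_eq_one _).mp (pingpong l k hl hk) w
  ext1 p
  apply hι
  rw [← key, hw, one_smul]; rfl

end PingPong

section Construction

theorem free_of_map {H K : Type*} [Group H] [Group K] (θ : H →* K) (u v : H)
    (h : IsFreePair (θ u) (θ v)) : IsFreePair u v := by
  unfold IsFreePair at *
  have e : (FreeGroup.lift (fun b : Bool => if b then θ u else θ v)) =
      θ.comp (FreeGroup.lift (fun b : Bool => if b then u else v)) := by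
    ext b
    cases b <;> simp
  rw [e, MonoidHom.coe_comp] at h
  exact h.of_comp

/-- the representation space -/
abbrev WW : Type := Fin 5 → Fin 5 → ℝ

/-- permutation representation on functions of two variables -/
def permRep : Equiv.Perm (Fin 5) →* Module.End ℝ WW where
  toFun g :=
    { toFun := fun F i j => F (g.symm i) (g.symm j)
      map_add' := fun _ _ => rfl
      map_smul' := fun _ _ => rfl }
  map_one' := rfl
  map_mul' _ _ := rfl

/-- `A₅` -/
abbrev A5 : Type := alternatingGroup (Fin 5)

/-- representation of the group ring of `A₅` -/
noncomputable def rep : MonoidAlgebra ℤ A5 →ₐ[ℤ] Module.End ℝ WW :=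
  MonoidAlgebra.lift ℤ (Module.End ℝ WW) A5 (permRep.comp (alternatingGroup (Fin 5)).subtype)

theorem rep_of (g : A5) : rep (MonoidAlgebra.of ℤ A5 g) = permRep g.1 := by
  simp [rep]

theorem permRep_apply (g : Equiv.Perm (Fin 5)) (F : WW) (i j : Fin 5) :
    permRep g F i j = F (g.symm i) (g.symm j) := rfl

/-- 5-cycle -/
def xP : Equiv.Perm (Fin 5) := ⟨![1, 2, 3, 4, 0], ![4, 0, 1, 2, 3], by decide, by decide⟩
/-- double transposition -/
def hP : Equiv.Perm (Fin 5) := ⟨![0, 2, 1, 4, 3], ![0, 2, 1, 4, 3], by decide, by decide⟩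
/-- 3-cycle -/
def yP : Equiv.Perm (Fin 5) := ⟨![2, 0, 1, 3, 4], ![1, 2, 0, 3, 4], by decide, by decide⟩

/-- 5-cycle -/
def xA : A5 := ⟨xP, by rw [Equiv.Perm.mem_alternatingGroup]; decide⟩
/-- double transposition -/
def hA : A5 := ⟨hP, by rw [Equiv.Perm.mem_alternatingGroup]; decide⟩
/-- 3-cycle -/
def yA : A5 := ⟨yP, by rw [Equiv.Perm.mem_alternatingGroup]; decide⟩

theorem order_xA : orderOf xA = 5 := by
  have : Fact (Nat.Prime 5) := ⟨by norm_num⟩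
  exact orderOf_eq_prime (by decide) (by decide)

theorem order_hA : orderOf hA = 2 :=
  orderOf_eq_prime (by decide) (by decide)

/-- golden ratio -/
local notation "φ" => Real.goldenRatio

/-- fixed vector of the 5-cycle -/
noncomputable def aV : WW :=
  ![![0, 3 - φ, 1 + 3 * φ, -(1 + 3 * φ), -(3 - φ)],
    ![-(3 - φ), 0, 3 - φ, 1 + 3 * φ, -(1 + 3 * φ)],
    ![-(1 + 3 * φ), -(3 - φ), 0, 3 - φ, 1 + 3 * φ],
    ![1 + 3 * φ, -(1 + 3 * φ), -(3 - φ), 0, 3 - φ],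
    ![3 - φ, 1 + 3 * φ, -(1 + 3 * φ), -(3 - φ), 0]]

/-- fixed vector of the involution -/
noncomputable def vV : WW :=
  ![![0, 5, 5, -5, -5],
    ![-5, 0, 0, 5 * φ, 5 - 5 * φ],
    ![-5, 0, 0, 5 - 5 * φ, 5 * φ],
    ![5, -(5 * φ), -(5 - 5 * φ), 0, 0],
    ![5, -(5 - 5 * φ), -(5 * φ), 0, 0]]

/-- component in the plane -/
noncomputable def bV : WW := vV - aV

theorem x_aV : permRep xP aV = aV := by
  funext i j
  rw [permRep_apply]
  fin_cases i <;> fin_cases j <;> rfl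

theorem h_vV : permRep hP vV = vV := by
  funext i j
  rw [permRep_apply]
  fin_cases i <;> fin_cases j <;> rfl

theorem x_bV : permRep xP (permRep xP bV) = (φ - 1) • permRep xP bV - bV := by
  have h5 : √5 ^ 2 = (5 : ℝ) := Real.sq_sqrt (by norm_num)
  funext i j
  simp only [Pi.sub_apply, Pi.smul_apply, smul_eq_mul, permRep_apply, bV]
  fin_cases i <;> fin_cases j <;> simp [xP, aV, vV] <;> ring_nf <;> linarith [h5]

theorem x_sum_bV : bV + permRep xP bV + permRep xP (permRep xP bV)
    + permRep xP (permRep xP (permRep xP bV))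
    + permRep xP (permRep xP (permRep xP (permRep xP bV))) = 0 := by
  funext i j
  simp only [Pi.add_apply, Pi.sub_apply, permRep_apply, bV]
  fin_cases i <;> fin_cases j <;> simp [xP, aV, vV] <;> ring_nf

theorem tau_aV : permRep yP (aV - permRep hP aV) + permRep hP (permRep yP (aV - permRep hP aV))
    = ((4 + 2 * φ) / 5) • vV := by
  have h5 : √5 ^ 2 = (5 : ℝ) := Real.sq_sqrt (by norm_num)
  funext i j
  simp only [Pi.sub_apply, Pi.smul_apply, smul_eq_mul, permRep_apply, Pi.add_apply]
  fin_cases i <;> fin_cases j <;> simp [hP, yP, aV, vV] <;> ring_nf <;> linarith [h5]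

theorem eig_pow {W : Type*} [AddCommGroup W] [Module ℝ W] (T : Module.End ℝ W) (w : W) (c : ℝ)
    (h : T w = c • w) (n : ℕ) : (T ^ n) w = c ^ n • w := by
  induction n with
  | zero => simp
  | succ n ih => rw [pow_succ, Module.End.mul_apply, h, map_smul, ih, smul_smul, pow_succ']

/-- the Bass unit -/
noncomputable def uB : MonoidAlgebra ℤ A5 := bassCyclic xA 2 20

theorem uB_eq : uB = (1 + MonoidAlgebra.of ℤ A5 xA) ^ 20 + (-209715 : ℤ) • hat xA := by
  unfold uB bassCyclic
  rw [order_xA]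
  have : ((1 - ((2 : ℕ) : ℤ) ^ 20) / ((5 : ℕ) : ℤ)) = -209715 := by norm_num
  rw [this, Finset.sum_range_succ, Finset.sum_range_one, pow_zero, pow_one]
  unfold hat
  rw [order_xA]

theorem rep_hat_x (w : WW) : rep (hat xA) w = w + permRep xP w + permRep xP (permRep xP w)
    + permRep xP (permRep xP (permRep xP w))
    + permRep xP (permRep xP (permRep xP (permRep xP w))) := by
  unfold hat
  rw [order_xA, map_sum]
  simp only [map_pow, rep_of, Finset.sum_range_succ, Finset.sum_range_zero]
  simp only [xA, pow_succ, pow_zero, one_mul, LinearMap.add_apply, Module.End.mul_apply,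
    Module.End.one_apply, zero_add]

theorem uB_aV : rep uB aV = aV := by
  rw [uB_eq, map_add, map_zsmul, map_pow, map_add, map_one, rep_of, LinearMap.add_apply,
    LinearMap.smul_apply, rep_hat_x]
  rw [eig_pow (1 + permRep xA.1) aV 2 (by
    rw [LinearMap.add_apply]
    change aV + permRep xP aV = _
    rw [x_aV, two_smul])]
  simp only [x_aV]
  module

theorem x_pow_ten : permRep xP ^ 10 = 1 := by
  rw [← map_pow, show xP ^ 10 = 1 by decide, map_one]

theorem one_add_x_sq (n : ℕ) : (((1 + permRep xP : Module.End ℝ WW) ^ 2) ^ n) bV =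
    (φ + 1) ^ n • (permRep xP ^ n) bV := by
  induction n with
  | zero => simp
  | succ n ih =>
    have hc : Commute ((1 + permRep xP : Module.End ℝ WW) ^ 2) (permRep xP ^ n) := by
      apply Commute.pow_pow
      exact (Commute.one_left _).add_left (Commute.refl _)
    have h1 : ((1 + permRep xP : Module.End ℝ WW) ^ 2) bV = (φ + 1) • permRep xP bV := by
      rw [pow_two, Module.End.mul_apply]
      simp only [LinearMap.add_apply, Module.End.one_apply, map_add, x_bV]
      module
    rw [pow_succ', Module.End.mul_apply, ih, map_smul, ← Module.End.mul_apply, hc.eq,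
      Module.End.mul_apply, h1, map_smul, smul_smul, ← pow_succ, ← Module.End.mul_apply,
      ← pow_succ]

theorem uB_bV : rep uB bV = (φ + 1) ^ 10 • bV := by
  rw [uB_eq, map_add, map_zsmul, map_pow, map_add, map_one, rep_of, LinearMap.add_apply,
    LinearMap.smul_apply, rep_hat_x, x_sum_bV, smul_zero, add_zero]
  have := one_add_x_sq 10
  rw [← pow_mul, x_pow_ten, Module.End.one_apply, show 2 * 10 = 20 by norm_num] at this
  simp only [xA]
  exact this

/-- the bicyclic unit -/
noncomputable def gB : MonoidAlgebra ℤ A5 := bicyclicGamma yA hA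

theorem rep_gB (w : WW) : rep gB w =
    w + (permRep yP (w - permRep hP w) + permRep hP (permRep yP (w - permRep hP w))) := by
  unfold gB bicyclicGamma hat
  rw [order_hA, Finset.sum_range_succ, Finset.sum_range_one, pow_zero, pow_one]
  simp only [map_add, map_one, map_mul, map_sub, rep_of, LinearMap.add_apply,
    Module.End.one_apply, Module.End.mul_apply, LinearMap.sub_apply]
  simp only [yA, hA]
  abel

theorem gB_vV : rep gB vV = vV := by
  rw [rep_gB, h_vV]; simp

theorem gB_aV (m : ℕ) : (rep gB ^ m) aV = aV + (m * ((4 + 2 * φ) / 5)) • vV := by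
  induction m with
  | zero => simp
  | succ m ih =>
    have h1 : rep gB aV = aV + ((4 + 2 * φ) / 5) • vV := by rw [rep_gB, tau_aV]
    have h2 : (rep gB ^ m) vV = vV := by
      have := eig_pow (rep gB) vV 1 (by rw [gB_vV, one_smul]) m
      simpa using this
    rw [pow_succ, Module.End.mul_apply, h1, map_add, map_smul, ih, h2]
    push_cast
    module

theorem gB_bV (m : ℕ) : (rep gB ^ m) bV = bV - (m * ((4 + 2 * φ) / 5)) • vV := by
  have h2 : (rep gB ^ m) vV = vV := by
    have := eig_pow (rep gB) vV 1 (by rw [gB_vV, one_smul]) m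
    simpa using this
  unfold bV
  rw [map_sub, gB_aV, h2]
  module

theorem gB_unit : IsUnit gB := by
  set τ := hat hA * MonoidAlgebra.of ℤ A5 yA * (1 - MonoidAlgebra.of ℤ A5 hA) with hτ
  have h0 : τ * τ = 0 := by
    have : (1 - MonoidAlgebra.of ℤ A5 hA) * hat hA = 0 := by
      rw [sub_mul, one_mul, of_mul_hat, sub_self]
    calc τ * τ = hat hA * MonoidAlgebra.of ℤ A5 yA * ((1 - MonoidAlgebra.of ℤ A5 hA) * hat hA)
          * MonoidAlgebra.of ℤ A5 yA * (1 - MonoidAlgebra.of ℤ A5 hA) := by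
            rw [hτ]; simp only [mul_assoc]
      _ = 0 := by rw [this]; simp
  have e : gB = 1 + τ := rfl
  refine ⟨⟨1 + τ, 1 - τ, ?_, ?_⟩, e.symm⟩
  · rw [add_mul, mul_sub, mul_sub, h0]; simp
  · rw [sub_mul, mul_add, mul_add, h0]; simp

theorem uB_unit : IsUnit uB := by
  set X := MonoidAlgebra.of ℤ A5 xA with hX
  set N := hat xA with hN
  set B := 1 + X ^ 2 + X ^ 4 with hB
  set A := 1 + X with hA'
  have hX5 : X ^ 5 = 1 := by
    have := of_pow_orderOf xA
    rwa [order_xA] at this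
  have hNX : N = 1 + X + X ^ 2 + X ^ 3 + X ^ 4 := by
    rw [hN, hat, order_xA]
    rw [Finset.sum_range_succ, Finset.sum_range_succ, Finset.sum_range_succ, Finset.sum_range_succ,
      Finset.sum_range_one, pow_zero, pow_one]
  have hNN : N * N = (5 : ℤ) • N := by
    have := hat_mul_hat xA
    rw [order_xA] at this
    exact this
  have hAB : A * B = 1 + (1 : ℤ) • N := by
    have : A * B = N + X ^ 5 := by rw [hNX, hA', hB]; noncomm_ring
    rw [this, hX5, one_smul, add_comm]
  have hBA : B * A = 1 + (1 : ℤ) • N := by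
    have : B * A = N + X ^ 5 := by rw [hNX, hA', hB]; noncomm_ring
    rw [this, hX5, one_smul, add_comm]
  have hc : Commute A B := by rw [Commute, SemiconjBy, hAB, hBA]
  have xN : ∀ i, X ^ i * N = N := of_pow_mul_hat xA
  have Nx : ∀ i, N * X ^ i = N := hat_mul_of_pow xA
  have hAN : A * N = (2 : ℤ) • N := by
    have := xN 1
    rw [pow_one] at this
    rw [hA', add_mul, one_mul, this, two_smul]
  have hNA : N * A = (2 : ℤ) • N := by
    have := Nx 1
    rw [pow_one] at this
    rw [hA', mul_add, mul_one, this, two_smul]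
  have hBN : B * N = (3 : ℤ) • N := by
    rw [hB, add_mul, add_mul, one_mul, xN, xN]; module
  have hNB : N * B = (3 : ℤ) • N := by
    rw [hB, mul_add, mul_add, mul_one, Nx, Nx]; module
  have cAN : Commute A N := by rw [Commute, SemiconjBy, hAN, hNA]
  have cBN : Commute B N := by rw [Commute, SemiconjBy, hBN, hNB]
  obtain ⟨e, he⟩ := pow_expand (1 : MonoidAlgebra ℤ A5) N 1 5 1 hNN (by simp) (by simp) 20
  obtain ⟨c, hcdef⟩ : ∃ c : ℤ, c = -209715 := ⟨_, rfl⟩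
  obtain ⟨c', hc'def⟩ : ∃ c : ℤ, c = (1 - 3 ^ 20) / 5 := ⟨_, rfl⟩
  have hu : uB = A ^ 20 + c • N := by rw [uB_eq, hcdef]
  have hcV : Commute uB (B ^ 20 + c' • N) := by
    rw [hu]
    refine Commute.add_left (Commute.add_right ?_ ?_) (Commute.add_right ?_ ?_)
    · exact hc.pow_pow _ _
    · exact (cAN.pow_left 20).smul_right c'
    · exact (cBN.symm.pow_right 20).smul_left c
    · exact ((Commute.refl N).smul_left c).smul_right c'
  have haug : augm A5 uB = 1 := augm_bass xA 2 20 (by rw [order_xA]; norm_num)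
    (by rw [order_xA, Nat.totient_prime (by norm_num)]; norm_num)
  have haugV : augm A5 (B ^ 20 + c' • N) = 1 := by
    rw [map_add, map_zsmul, hN, augm_hat, order_xA, map_pow, hB, map_add, map_add, map_pow, map_pow,
      augm_of, map_one, hc'def]
    norm_num
  have hprod : uB * (B ^ 20 + c' • N) = 1 := by
    refine eq_of_augm xA (by rw [order_xA]; norm_num) _ _
      (e + c' * 2 ^ 20 + c * 3 ^ 20 + c * c' * 5) ?_ ?_ (map_one _)
    · have hNB20 : N * B ^ 20 = (3 : ℤ) ^ 20 • N := by
        rw [(cBN.symm.pow_right 20).eq]; exact pow_mul_absorb _ _ _ hBN 20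
      rw [hu, add_mul, mul_add, mul_add, ← hc.mul_pow, hAB, he, mul_smul_comm,
        pow_mul_absorb _ _ _ hAN 20, smul_mul_assoc, hNB20, smul_mul_assoc, mul_smul_comm, hNN,
        one_pow]
      module
    · rw [map_mul, haug, haugV, one_mul]
  exact ⟨⟨uB, B ^ 20 + c' • N, hprod, by rw [← hcV.eq, hprod]⟩, rfl⟩

/-- the embedding of the plane -/
noncomputable def emb (p : NZ) : WW := p.1.1 • aV + p.1.2 • bV

theorem emb_inj : Function.Injective emb := by
  intro p q h
  have h1 := congrFun (congrFun h 1) 2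
  have h2 := congrFun (congrFun h 0) 1
  simp only [emb, Pi.add_apply, Pi.smul_apply, bV, Pi.sub_apply, smul_eq_mul, aV, vV] at h1 h2
  simp at h1 h2
  have hφ : φ < 2 := Real.goldenRatio_lt_two
  have h3 : (p.1.1 - p.1.2 - (q.1.1 - q.1.2)) * (3 - φ) = 0 := by linear_combination h1
  have h4 : p.1.1 - p.1.2 - (q.1.1 - q.1.2) = 0 := by
    rcases mul_eq_zero.mp h3 with h | h
    · exact h
    · linarith
  have h5 : p.1.1 = q.1.1 := by
    linear_combination (1 / 5 : ℝ) * h2 + (1 / 5 : ℝ) * (2 + φ) * h4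
  exact Subtype.ext (Prod.ext h5 (by linarith))

theorem A5_has : HasBassBicyclicFreePair A5 := by
  obtain ⟨u, hu⟩ := uB_unit
  obtain ⟨g, hg⟩ := gB_unit
  refine ⟨u, g, 4, by norm_num, ⟨xA, 2, 20, by norm_num, by norm_num, by rw [order_xA]; norm_num,
    by rw [order_xA, Nat.totient_prime (by norm_num)]; norm_num, hu⟩, ⟨yA, hA, Or.inr hg⟩, ?_⟩
  have hφ : (3 / 2 : ℝ) < φ := by
    have h5 : (2 : ℝ) < √5 := by
      rw [Real.lt_sqrt (by norm_num)]; norm_num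
    unfold Real.goldenRatio; linarith
  apply free_of_map (Units.map (rep : MonoidAlgebra ℤ A5 →* Module.End ℝ WW))
  refine free_of_intertwine (W := WW) emb emb_inj _ _ ((φ + 1) ^ 10)
    (((4 : ℕ) : ℝ) * ((4 + 2 * φ) / 5)) ?_ ?_ ?_ ?_
  · have : (2 : ℝ) ^ 10 ≤ (φ + 1) ^ 10 := by gcongr; linarith
    linarith
  · push_cast; linarith
  · intro p
    change rep (u : MonoidAlgebra ℤ A5) (emb p) = _
    rw [hu]
    simp only [emb, map_add, map_smul, uB_aV, uB_bV, diagPerm, Equiv.coe_fn_mk]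
    module
  · intro p
    rw [map_pow]
    change (rep (g : MonoidAlgebra ℤ A5) ^ 4) (emb p) = _
    rw [hg]
    simp only [emb, map_add, map_smul, gB_aV, gB_bV, transPerm, Equiv.coe_fn_mk]
    have : vV = aV + bV := by unfold bV; abel
    rw [this]
    module

end Construction

section Final

theorem perm_has (n : ℕ) (h : 5 ≤ n) : HasBassBicyclicFreePair (Equiv.Perm (Fin n)) := by
  refine transfer ((Equiv.Perm.viaEmbeddingHom (Fin.castLEEmb h)).comp
    (alternatingGroup (Fin 5)).subtype) ?_ A5_has
  exact (Equiv.Perm.viaEmbeddingHom_injective _).comp Subtype.val_injective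

theorem alt_has (n : ℕ) (h : 5 ≤ n) : HasBassBicyclicFreePair (alternatingGroup (Fin n)) := by
  let f := (Equiv.Perm.viaEmbeddingHom (Fin.castLEEmb h)).comp
    (alternatingGroup (Fin 5)).subtype
  have hf : Function.Injective f :=
    (Equiv.Perm.viaEmbeddingHom_injective _).comp Subtype.val_injective
  have hmem : ∀ g, f g ∈ alternatingGroup (Fin n) := by
    intro g
    rw [Equiv.Perm.mem_alternatingGroup]
    have h1 := Equiv.Perm.mem_alternatingGroup.mp g.2
    have e : f g = Equiv.Perm.extendDomain g.1
        (Equiv.ofInjective (Fin.castLEEmb h).1 (Fin.castLEEmb h).2) := by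
      change Equiv.Perm.viaEmbedding g.1 (Fin.castLEEmb h) = _
      unfold Equiv.Perm.viaEmbedding
      congr!
    rw [e, Equiv.Perm.sign_extendDomain]
    exact h1
  refine transfer (f.codRestrict _ hmem) ?_ A5_has
  intro a b hab
  exact hf (congrArg Subtype.val hab)

end Final

/-- **Theorem 7.3.** For `n ≥ 1`, the group ring `ℤSₙ` (resp. `ℤAₙ`) contains a free
pair formed by a Bass cyclic unit and a positive power of a bicyclic unit if and only
if `n ≥ 5`. -/
theorem symm_alt_bass_bicyclic_free_pair (n : ℕ) (hn : 1 ≤ n) :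
    (HasBassBicyclicFreePair (Equiv.Perm (Fin n)) ↔ 5 ≤ n) ∧
    (HasBassBicyclicFreePair (alternatingGroup (Fin n)) ↔ 5 ≤ n) := by
  refine ⟨⟨fun h => ?_, perm_has n⟩, ⟨fun h => ?_, alt_has n⟩⟩
  · by_contra hlt
    exact no_free_pair (perm_small n hn (by omega)) h
  · by_contra hlt
    refine no_free_pair (fun g => ?_) h
    obtain ⟨e, h1, h2, h3⟩ := perm_small n hn (by omega) g.1
    exact ⟨e, h1, h2, Subtype.ext (by simpa using h3)⟩
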